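/- For any τ ∈ [2, ∞] there exist uncountably many elements ξ of the Cantor set 𝒞 with irrationality exponent τ(ξ) = τ. -/

import Mathlib

/-!
Setting: `𝔽₃((X⁻¹))`, the field of formal Laurent series over the field `𝔽₃` with `3` elements,
with absolute value `|f| = 3^N` when `f = ∑_{n ≥ -N} a_{-n} X^{-n}` with `a_N ≠ 0`, `|0| = 0`.
We model it as `LaurentSeries (ZMod 3)` in the variable `t = X⁻¹`, so the coefficient
`a_{-n}` of `X^{-n}` is the coefficient of `t^n`, and `|f| = 3^{-ord_t f}`.
-/

noncomputable section
open scoped ENNReal Classical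

instance : Fact (Nat.Prime 3) := ⟨by norm_num⟩

/-- The field with three elements. -/
abbrev F3 := ZMod 3

/-- The field `𝔽₃((X⁻¹))`, modelled as Laurent series in `t = X⁻¹`. -/
abbrev L3 := LaurentSeries F3

/-- The element `X`, i.e. `t⁻¹`. -/
def XL : L3 := HahnSeries.single (-1 : ℤ) 1

/-- The absolute value: `|f| = 3^{-ord_t f}` for `f ≠ 0` and `|0| = 0`. -/
def absv (f : L3) : ℝ := if f = 0 then 0 else (3 : ℝ) ^ (-f.order)

/-- The ball of radius `r` around `x` for the ultrametric `d(x, y) = |x - y|`. -/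
def ball (x : L3) (r : ℝ) : Set L3 := {y | absv (y - x) < r}

/-- The unit ball `𝕀 = {h : |h| < 1}` around `0`. -/
def unitBall : Set L3 := ball 0 1

/-- The Cantor set `𝒞`: elements of `𝕀` all of whose coefficients `a_{-n}` lie in `{0, 2}`. -/
def Cantor : Set L3 :=
  {f | (∀ m : ℤ, m ≤ 0 → f.coeff m = 0) ∧ ∀ m : ℤ, 1 ≤ m → f.coeff m = 0 ∨ f.coeff m = 2}

/-- `γ = log 2 / log 3`. -/
def gam : ℝ := Real.log 2 / Real.log 3

/-- The Hausdorff `f`-measure of `A ⊆ 𝔽₃((X⁻¹))`, as defined in the paper: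
`ℋ^f(A) = lim_{ρ → 0} inf ∑ᵢ f(r(Bᵢ))`, the infimum being over countable covers of `A`
by balls `Bᵢ` with radius `r(Bᵢ) ≤ ρ`.  Every ball has radius `3^k` for some `k ∈ ℤ`;
a ball is recorded as a pair (centre, k).  (The `⨆` over `ρ` is the limit `ρ → 0`, the inner
infimum being antitone in `ρ`.) -/
def hmeas (f : ℝ → ℝ) (A : Set L3) : ℝ≥0∞ :=
  ⨆ (ρ : ℝ) (_ : 0 < ρ),
    ⨅ (S : Set (L3 × ℤ)) (_ : S.Countable)
      (_ : ∀ p ∈ S, (3 : ℝ) ^ p.2 ≤ ρ)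
      (_ : A ⊆ ⋃ p ∈ S, ball p.1 ((3 : ℝ) ^ p.2)),
      ∑' p : S, ENNReal.ofReal (f ((3 : ℝ) ^ (p : L3 × ℤ).2))

/-- The Hausdorff `γ`-measure `ℋ^γ`. -/
def hgamma (A : Set L3) : ℝ≥0∞ := hmeas (fun r => r ^ gam) A

/-- `μ(A) = ℋ^γ(A ∩ 𝒞)`. -/
def mu (A : Set L3) : ℝ≥0∞ := hgamma (A ∩ Cantor)

/-- A dimension function: a continuous, non-decreasing `f : ℝ_{≥0} → ℝ_{≥0}` with `f 0 = 0`. -/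
structure IsDimFun (f : ℝ → ℝ) : Prop where
  mono : MonotoneOn f (Set.Ici 0)
  cont : ContinuousOn f (Set.Ici 0)
  zero : f 0 = 0
  nonneg : ∀ r, 0 ≤ r → 0 ≤ f r

/-- The image of a polynomial `g ∈ 𝔽₃[X]` in `𝔽₃((X⁻¹))`. -/
def toL (g : Polynomial F3) : L3 := Polynomial.aeval XL g

/-- `ℱ(N)`: polynomials over `𝔽₃` of degree `< N`, all of whose coefficients
`a_0, …, a_{N-1}` lie in `{0, 2}`. -/
def Fset (N : ℕ) : Set (Polynomial F3) :=
  {g | g.degree < (N : ℕ) ∧ ∀ k < N, g.coeff k = 0 ∨ g.coeff k = 2}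

/-- `ℱ*(N)`: members of `ℱ(N)` with `g(0) = 2`. -/
def FsetStar (N : ℕ) : Set (Polynomial F3) :=
  {g | g.degree < (N : ℕ) ∧ (∀ k < N, g.coeff k = 0 ∨ g.coeff k = 2) ∧ g.coeff 0 = 2}

/-- `W_𝒞(ψ)`: elements `h ∈ 𝒞` with `|h - g/X^N| < ψ(3^N)` for infinitely many `N ∈ ℕ`,
where `g ∈ ℱ(N)`.  Here `ψ N` stands for `ψ(3^N)`. -/
def Wc (ψ : ℕ → ℝ) : Set L3 :=
  {h ∈ Cantor | ∀ m : ℕ, ∃ N : ℕ, m ≤ N ∧ 1 ≤ N ∧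
    ∃ g ∈ Fset N, absv (h - toL g / XL ^ N) < ψ N}

/-- `W*_𝒞(ψ)`: defined like `W_𝒞(ψ)`, with `ℱ*(N)` in place of `ℱ(N)`. -/
def WcStar (ψ : ℕ → ℝ) : Set L3 :=
  {h ∈ Cantor | ∀ m : ℕ, ∃ N : ℕ, m ≤ N ∧ 1 ≤ N ∧
    ∃ g ∈ FsetStar N, absv (h - toL g / XL ^ N) < ψ N}

/-- `A*_n = ⋃_{g ∈ ℱ*(n)} B(g/Xⁿ, ψ(3ⁿ))`. -/
def Astar (ψ : ℕ → ℝ) (n : ℕ) : Set L3 :=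
  ⋃ g ∈ FsetStar n, ball (toL g / XL ^ n) (ψ n)

/-- `𝒦(ψ)`: elements `ξ ∈ 𝕀` with `|ξ - g/h| < ψ(|h|)` for infinitely many fractions
`g/h ∈ 𝔽₃(X)`.  Here `ψ d` stands for `ψ(3^d)`, and `|h| = 3^{deg h}`. -/
def Kset (ψ : ℕ → ℝ) : Set L3 :=
  {ξ ∈ unitBall | {gh : Polynomial F3 × Polynomial F3 | gh.2 ≠ 0 ∧
    absv (ξ - toL gh.1 / toL gh.2) < ψ gh.2.natDegree}.Infinite}

/-- The irrationality exponent
`τ(ξ) = sup {τ : |ξ - g/h| < |h|^{-τ} for infinitely many g/h ∈ 𝔽₃(X)}`, valued in `[0, ∞]`. -/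
def irrExp (ξ : L3) : ℝ≥0∞ :=
  sSup {t : ℝ≥0∞ | ∃ τ : ℝ, t = ENNReal.ofReal τ ∧
    {gh : Polynomial F3 × Polynomial F3 | gh.2 ≠ 0 ∧
      absv (ξ - toL gh.1 / toL gh.2) < absv (toL gh.2) ^ (-τ)}.Infinite}

open Polynomial in
theorem mul_X_pow_sub_ne_zero {P g h : F3[X]} {n : ℕ} (hP : P.coeff 0 ≠ 0) (hh : h ≠ 0)
    (hn : h.natDegree < n) : g * X ^ n - h * P ≠ 0 := by
  intro H
  have hd : (X : F3[X]) ^ n ∣ h * P := ⟨g, by rw [mul_comm _ g]; exact (sub_eq_zero.mp H).symm⟩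
  have h1 : (X : F3[X]) ^ n ∣ h :=
    Polynomial.prime_X.pow_dvd_of_dvd_mul_right n (by rwa [X_dvd_iff]) hd
  have := natDegree_le_of_dvd h1 hh
  rw [natDegree_X_pow] at this
  omega

/-- The numerators of the partial sums of the series `2 * ∑ X ^ (-m i)`, over the
denominators `X ^ m k`. -/
def numer (m : ℕ → ℕ) : ℕ → Polynomial F3
  | 0 => 2
  | k + 1 => numer m k * Polynomial.X ^ (m (k + 1) - m k) + 2

theorem numer_coeff_zero {m : ℕ → ℕ} (hm : StrictMono m) (k : ℕ) :
    (numer m k).coeff 0 ≠ 0 := by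
  have h2 : (2 : Polynomial F3).coeff 0 = 2 := by
    rw [Polynomial.coeff_zero_eq_eval_zero]; simp
  have h20 : (2 : F3) ≠ 0 := by decide
  cases k with
  | zero => rwa [numer, h2]
  | succ k =>
    have : m k < m (k + 1) := hm k.lt_succ_self
    have h0 : m (k + 1) - m k ≠ 0 := by omega
    rw [numer, Polynomial.coeff_add, h2, Polynomial.coeff_zero_eq_eval_zero]
    simpa [h0] using h20

open Polynomial in
theorem le_natDegree_mul_X_pow_sub {m : ℕ → ℕ} (hm : StrictMono m)
    (hm2 : ∀ k, 2 * m k ≤ m (k + 1)) {T K : ℝ} (hT : 2 ≤ T) (hK0 : (m 0 : ℝ) ≤ K)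
    (hK : ∀ k, (m (k + 1) : ℝ) ≤ T * m k + K) (k : ℕ) (g h : F3[X]) (hh : h ≠ 0)
    (hd : h.natDegree < m k) :
    (m k : ℝ) + h.natDegree ≤
      (g * X ^ m k - h * numer m k).natDegree + T * h.natDegree + K := by
  induction k generalizing g h with
  | zero =>
    have h1 : (0 : ℝ) ≤ (g * X ^ m 0 - h * numer m 0).natDegree := by positivity
    have h2 : (0 : ℝ) ≤ h.natDegree := by positivity
    nlinarith
  | succ k ih =>
    obtain ⟨e, he⟩ : ∃ e, m (k + 1) = 2 * m k + e := ⟨_, (Nat.add_sub_cancel' (hm2 k)).symm⟩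
    have hR0 := mul_X_pow_sub_ne_zero (g := g) (numer_coeff_zero hm (k + 1)) hh hd
    have hKk := hK k
    set P := numer m k with hP
    set w := g * X ^ m k - h * P with hw
    set R := g * X ^ m (k + 1) - h * numer m (k + 1) with hR
    have h3 : (3 : F3[X]) = 0 := CharP.cast_eq_zero F3[X] 3
    have hRw : R = X ^ (m k + e) * w + h := by
      have : m (k + 1) - m k = m k + e := by omega
      rw [hR, hw, numer, this, ← hP, he]
      linear_combination (-h) * h3
    have hdeg : w ≠ 0 → (X ^ (m k + e) * w).natDegree = m k + e + w.natDegree := fun hw0 => by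
      rw [natDegree_mul (pow_ne_zero _ X_ne_zero) hw0, natDegree_X_pow]
    rcases lt_or_ge h.natDegree (m k) with hlt | hge
    · have hw0 : w ≠ 0 := mul_X_pow_sub_ne_zero (numer_coeff_zero hm k) hh hlt
      have hr : R.natDegree = m k + e + w.natDegree := by
        rw [hRw, natDegree_add_eq_left_of_natDegree_lt, hdeg hw0]
        rw [hdeg hw0]; omega
      have := ih g h hh hlt
      rw [hr, he]
      push_cast
      linarith
    have hge' : (m k : ℝ) ≤ h.natDegree := by exact_mod_cast hge
    rcases lt_or_ge R.natDegree (m k) with hlt | hge2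
    · have hw0 : w ≠ 0 := by
        rintro h0
        rw [h0, mul_zero, zero_add] at hRw
        rw [hRw] at hlt
        omega
      have hdw : h.natDegree = m k + e + w.natDegree := by
        rw [← hdeg hw0, ← natDegree_neg]
        have : X ^ (m k + e) * w = -h + R := by rw [hRw]; ring
        rw [this, natDegree_add_eq_left_of_natDegree_lt]
        rw [natDegree_neg]; omega
      have hdual : (g + P * X ^ e * w) * X ^ m k - R * P = w := by
        rw [hRw, hw]; ring
      have := ih (g + P * X ^ e * w) R hR0 hlt
      rw [hdual] at this
      rw [he]
      have hlt' : (R.natDegree : ℝ) ≤ h.natDegree := by exact_mod_cast (hlt.trans_le hge).le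
      have hdw' : (h.natDegree : ℝ) = m k + e + w.natDegree := by exact_mod_cast hdw
      push_cast
      nlinarith
    · have hge2' : (m k : ℝ) ≤ R.natDegree := by exact_mod_cast hge2
      nlinarith

theorem absv_nonneg (f : L3) : 0 ≤ absv f := by
  unfold absv; split_ifs <;> positivity

theorem absv_of_ne_zero {f : L3} (hf : f ≠ 0) : absv f = (3 : ℝ) ^ (-f.order) := if_neg hf

theorem absv_mul (f g : L3) : absv (f * g) = absv f * absv g := by
  by_cases hf : f = 0
  · simp [absv, hf]
  by_cases hg : g = 0
  · simp [absv, hg]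
  rw [absv_of_ne_zero hf, absv_of_ne_zero hg, absv_of_ne_zero (mul_ne_zero hf hg),
    HahnSeries.order_mul hf hg, ← zpow_add₀ (by norm_num), neg_add]

theorem absv_add_le (f g : L3) : absv (f + g) ≤ max (absv f) (absv g) := by
  by_cases hf : f = 0
  · simp [hf]
  by_cases hg : g = 0
  · simp [hg]
  by_cases hfg : f + g = 0
  · rw [hfg, absv, if_pos rfl]
    exact (absv_nonneg f).trans (le_max_left _ _)
  have := HahnSeries.min_order_le_order_add hfg
  rw [absv_of_ne_zero hf, absv_of_ne_zero hg, absv_of_ne_zero hfg]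
  rcases min_le_iff.mp this with h | h
  · exact le_max_of_le_left (zpow_le_zpow_right₀ (by norm_num) (by omega))
  · exact le_max_of_le_right (zpow_le_zpow_right₀ (by norm_num) (by omega))

theorem absv_neg (f : L3) : absv (-f) = absv f := by
  simp [absv, HahnSeries.order_neg]

theorem absv_le_of_absv_lt {f g : L3} (h : absv f < absv g) : absv g ≤ absv (g - f) := by
  have h1 : absv g ≤ max (absv (g - f)) (absv f) := by simpa using absv_add_le (g - f) f
  exact (le_max_iff.mp h1).resolve_right h.not_ge

theorem absv_eq_of_coeff {f : L3} {n : ℤ} (h0 : ∀ j < n, f.coeff j = 0) (hn : f.coeff n ≠ 0) :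
    absv f = (3 : ℝ) ^ (-n) := by
  have hf : f ≠ 0 := by rintro rfl; simp at hn
  rw [absv_of_ne_zero hf, le_antisymm (HahnSeries.order_le_of_coeff_ne_zero hn)
    ((HahnSeries.le_order_iff_forall hf).mpr h0)]

theorem XL_pow (n : ℕ) : XL ^ n = HahnSeries.single (-(n : ℤ)) (1 : F3) := by
  simp [XL, HahnSeries.single_pow]

theorem XL_ne_zero : XL ≠ 0 := by simp [XL]

theorem toL_add (p q : Polynomial F3) : toL (p + q) = toL p + toL q := map_add _ p q

theorem toL_sub (p q : Polynomial F3) : toL (p - q) = toL p - toL q := map_sub _ p q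

theorem toL_mul (p q : Polynomial F3) : toL (p * q) = toL p * toL q := map_mul _ p q

theorem toL_X_pow (n : ℕ) : toL (Polynomial.X ^ n) = XL ^ n := by simp [toL]

theorem toL_C (a : F3) : toL (Polynomial.C a) = HahnSeries.C a := by
  rw [toL, Polynomial.aeval_C]
  exact congrFun (congrArg DFunLike.coe (Subsingleton.elim (algebraMap F3 L3) HahnSeries.C)) a

theorem coeff_toL (p : Polynomial F3) (j : ℤ) :
    (toL p).coeff j = if j ≤ 0 then p.coeff (-j).toNat else 0 := by
  induction p using Polynomial.induction_on' with
  | add p q hp hq =>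
    rw [toL_add, HahnSeries.coeff_add, hp, hq]
    split_ifs <;> simp
  | monomial n a =>
    rw [← Polynomial.C_mul_X_pow_eq_monomial, toL_mul, toL_C, toL_X_pow, XL_pow,
      HahnSeries.C_apply, HahnSeries.single_mul_single, Polynomial.coeff_C_mul_X_pow,
      HahnSeries.coeff_single]
    split_ifs <;> first | omega | simp

theorem absv_toL {p : Polynomial F3} (hp : p ≠ 0) : absv (toL p) = (3 : ℝ) ^ p.natDegree := by
  rw [absv_eq_of_coeff (n := -(p.natDegree : ℤ)), neg_neg, zpow_natCast]
  · intro j hj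
    rw [coeff_toL, if_pos (by omega)]
    exact Polynomial.coeff_eq_zero_of_natDegree_lt (by omega)
  · rw [coeff_toL, if_pos (by omega)]
    simpa using hp

theorem toL_ne_zero {p : Polynomial F3} (hp : p ≠ 0) : toL p ≠ 0 := by
  intro h
  have := absv_toL hp
  rw [h, absv, if_pos rfl] at this
  exact absurd this (by positivity)

theorem absv_XL_pow (n : ℕ) : absv (XL ^ n) = (3 : ℝ) ^ n := by
  rw [← toL_X_pow, absv_toL (pow_ne_zero _ Polynomial.X_ne_zero), Polynomial.natDegree_X_pow]

/-- The series `2 * ∑ X ^ (-m i)`, for `m` strictly increasing. -/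
def lacunary (m : ℕ → ℕ) : L3 :=
  HahnSeries.ofPowerSeries ℤ F3 (PowerSeries.mk fun n => if n ∈ Set.range m then 2 else 0)

theorem coeff_lacunary (m : ℕ → ℕ) (j : ℤ) :
    (lacunary m).coeff j = if ∃ i, (m i : ℤ) = j then 2 else 0 := by
  rw [lacunary, PowerSeries.coeff_coe, PowerSeries.coeff_mk]
  split_ifs with h1 h2 h2 h3 h3
  · obtain ⟨i, hi⟩ := h2
    omega
  · rfl
  · rfl
  · obtain ⟨i, hi⟩ := h2
    exact absurd ⟨i, by omega⟩ h3
  · obtain ⟨i, hi⟩ := h3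
    exact absurd ⟨i, by omega⟩ h2
  · rfl

theorem lacunary_mem_Cantor {m : ℕ → ℕ} (hm : StrictMono m) (h0 : 0 < m 0) :
    lacunary m ∈ Cantor := by
  refine ⟨fun j hj => ?_, fun j _ => ?_⟩
  · rw [coeff_lacunary, if_neg]
    rintro ⟨i, hi⟩
    have := hm.monotone i.zero_le
    omega
  · rw [coeff_lacunary]
    split_ifs <;> simp

theorem lacunary_injOn : Set.InjOn lacunary {m | StrictMono m} := by
  intro m hm m' hm' h
  rw [← StrictMono.range_inj hm hm']
  ext n
  have h2 : (2 : F3) ≠ 0 := by decide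
  have := congrArg (fun f => f.coeff (n : ℤ)) h
  simp only [coeff_lacunary, Nat.cast_inj] at this
  by_cases h1 : ∃ i, m i = n <;> by_cases h3 : ∃ i, m' i = n <;> simp_all

theorem coeff_toL_numer_div {m : ℕ → ℕ} (hm : StrictMono m) (k : ℕ) (j : ℤ) :
    (toL (numer m k) / XL ^ m k).coeff j = if ∃ i ≤ k, (m i : ℤ) = j then 2 else 0 := by
  have hX : ∀ n : ℕ, (XL ^ n)⁻¹ = HahnSeries.single (n : ℤ) (1 : F3) := fun n => by
    rw [XL_pow, HahnSeries.inv_single]; simp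
  have h2 : toL 2 = HahnSeries.single 0 (2 : F3) := by
    have : (2 : Polynomial F3) = Polynomial.C 2 := rfl
    rw [this, toL_C, HahnSeries.C_apply]
  have hsum : ∀ n : ℕ, toL 2 / XL ^ n = HahnSeries.single (n : ℤ) (2 : F3) := fun n => by
    rw [div_eq_mul_inv, hX, h2, HahnSeries.single_mul_single]; simp
  induction k with
  | zero =>
    rw [numer, hsum, HahnSeries.coeff_single]
    simp [eq_comm]
  | succ k ih =>
    have hlt : m k < m (k + 1) := hm k.lt_succ_self
    have : toL (numer m (k + 1)) / XL ^ m (k + 1) =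
        toL (numer m k) / XL ^ m k + toL 2 / XL ^ m (k + 1) := by
      rw [numer, toL_add, toL_mul, toL_X_pow, add_div]
      congr 1
      rw [div_eq_div_iff (pow_ne_zero _ XL_ne_zero) (pow_ne_zero _ XL_ne_zero), mul_assoc,
        ← pow_add, Nat.sub_add_cancel hlt.le]
    rw [this, HahnSeries.coeff_add, ih, hsum, HahnSeries.coeff_single]
    by_cases hj : j = m (k + 1)
    · have h1 : ¬ ∃ i ≤ k, (m i : ℤ) = j := by
        rintro ⟨i, hi, h⟩
        have := hm.monotone hi
        omega
      rw [if_neg h1, if_pos hj, if_pos ⟨k + 1, le_rfl, hj.symm⟩, zero_add]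
    · rw [if_neg hj, add_zero]
      congr 1
      refine propext ⟨fun ⟨i, hi, h⟩ => ⟨i, hi.trans k.le_succ, h⟩, fun ⟨i, hi, h⟩ => ⟨i, ?_, h⟩⟩
      rcases Nat.le_succ_iff.mp hi with h' | rfl
      · exact h'
      · exact absurd h.symm hj

theorem absv_lacunary_sub {m : ℕ → ℕ} (hm : StrictMono m) (k : ℕ) :
    absv (lacunary m - toL (numer m k) / XL ^ m k) = (3 : ℝ) ^ (-(m (k + 1) : ℤ)) := by
  apply absv_eq_of_coeff
  · intro j hj
    rw [HahnSeries.coeff_sub, coeff_lacunary, coeff_toL_numer_div hm, sub_eq_zero]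
    congr 1
    refine propext ⟨fun ⟨i, h⟩ => ⟨i, ?_, h⟩, fun ⟨i, _, h⟩ => ⟨i, h⟩⟩
    rw [← Nat.lt_succ_iff, Nat.succ_eq_add_one, ← hm.lt_iff_lt]
    omega
  · rw [HahnSeries.coeff_sub, coeff_lacunary, coeff_toL_numer_div hm, if_pos ⟨_, rfl⟩, if_neg]
    · decide
    · rintro ⟨i, hi, h⟩
      have := hm.monotone hi
      have : m k < m (k + 1) := hm k.lt_succ_self
      omega

theorem le_irrExp_lacunary {m : ℕ → ℕ} (hm : StrictMono m) {t : ℝ} {k₀ : ℕ}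
    (ht : ∀ k ≥ k₀, t * m k < m (k + 1)) : ENNReal.ofReal t ≤ irrExp (lacunary m) := by
  refine le_sSup ⟨t, rfl, ?_⟩
  refine Set.infinite_of_injective_forall_mem
    (f := fun k : ℕ => (numer m (k + k₀), (Polynomial.X : Polynomial F3) ^ m (k + k₀))) ?_ ?_
  · intro k l h
    have := congrArg (fun p : Polynomial F3 × Polynomial F3 => p.2.natDegree) h
    simp only [Polynomial.natDegree_X_pow] at this
    have := hm.injective this
    omega
  · intro k
    refine ⟨pow_ne_zero _ Polynomial.X_ne_zero, ?_⟩
    dsimp only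
    rw [toL_X_pow, absv_lacunary_sub hm, absv_XL_pow, ← Real.rpow_natCast, ← Real.rpow_intCast,
      ← Real.rpow_mul (by norm_num)]
    apply Real.rpow_lt_rpow_of_exponent_lt (by norm_num)
    have := ht (k + k₀) (by omega)
    push_cast
    linarith

theorem le_absv_lacunary_sub {m : ℕ → ℕ} (hm : StrictMono m)
    (hm2 : ∀ k, 2 * m k ≤ m (k + 1)) {T K : ℝ} (hT : 2 ≤ T) (hK0 : (m 0 : ℝ) ≤ K)
    (hK : ∀ k, (m (k + 1) : ℝ) ≤ T * m k + K) (g h : Polynomial F3) (hh : h ≠ 0) :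
    (3 : ℝ) ^ (-(T * h.natDegree + K)) ≤ absv (lacunary m - toL g / toL h) := by
  obtain ⟨k, hk⟩ : ∃ k, h.natDegree < m k :=
    ⟨h.natDegree + 1, (Nat.lt_succ_self _).trans_le (hm.le_apply)⟩
  have hX0 : XL ^ m k ≠ 0 := pow_ne_zero _ XL_ne_zero
  have hh0 := toL_ne_zero hh
  set w := g * Polynomial.X ^ m k - h * numer m k with hw
  have hw0 : w ≠ 0 := mul_X_pow_sub_ne_zero (numer_coeff_zero hm k) hh hk
  have hmul : absv (toL g / toL h - toL (numer m k) / XL ^ m k) * absv (toL h * XL ^ m k) =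
      absv (toL w) := by
    rw [← absv_mul, hw, toL_sub, toL_mul, toL_mul, toL_X_pow]
    congr 1
    field_simp
  rw [absv_mul, absv_toL hh, absv_toL hw0, absv_XL_pow, ← pow_add] at hmul
  have hfrac : absv (toL g / toL h - toL (numer m k) / XL ^ m k) =
      (3 : ℝ) ^ ((w.natDegree : ℝ) - (h.natDegree + m k)) := by
    rw [Real.rpow_sub (by norm_num), eq_div_iff (by positivity)]
    exact_mod_cast hmul
  have htail := absv_lacunary_sub hm k
  rw [← Real.rpow_intCast] at htail
  have hlt : absv (lacunary m - toL (numer m k) / XL ^ m k) <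
      absv (toL g / toL h - toL (numer m k) / XL ^ m k) := by
    rw [hfrac, htail]
    apply Real.rpow_lt_rpow_of_exponent_lt (by norm_num)
    have h1 : (2 : ℝ) * m k ≤ m (k + 1) := by exact_mod_cast hm2 k
    have h2 : (h.natDegree : ℝ) < m k := by exact_mod_cast hk
    have h3 : (0 : ℝ) ≤ w.natDegree := by positivity
    push_cast
    linarith
  have hle := absv_le_of_absv_lt hlt
  rw [sub_sub_sub_cancel_right, ← absv_neg (toL g / toL h - lacunary m), neg_sub, hfrac] at hle
  refine le_trans (Real.rpow_le_rpow_of_exponent_le (by norm_num) ?_) hle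
  have := le_natDegree_mul_X_pow_sub hm hm2 hT hK0 hK k g h hh hk
  rw [← hw] at this
  linarith

theorem finite_setOf_natDegree_le (D : ℕ) : {p : Polynomial F3 | p.natDegree ≤ D}.Finite := by
  refine Set.Finite.of_finite_image (f := fun p (i : Fin (D + 1)) => p.coeff i)
    (Set.toFinite _) fun p hp q hq h => ?_
  ext i
  by_cases hi : i < D + 1
  · exact congrFun h ⟨i, hi⟩
  · rw [Polynomial.coeff_eq_zero_of_natDegree_lt (by grind),
      Polynomial.coeff_eq_zero_of_natDegree_lt (by grind)]

theorem absv_le_one_of_mem_Cantor {f : L3} (hf : f ∈ Cantor) : absv f ≤ 1 := by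
  by_cases h0 : f = 0
  · simp [absv, h0]
  · rw [absv_of_ne_zero h0]
    refine zpow_le_one_of_nonpos₀ (by norm_num) ?_
    have : (0 : ℤ) ≤ f.order :=
      (HahnSeries.le_order_iff_forall h0).mpr fun j hj => hf.1 j hj.le
    omega

theorem irrExp_lacunary_le {m : ℕ → ℕ} (hm : StrictMono m) (h0 : 0 < m 0)
    (hm2 : ∀ k, 2 * m k ≤ m (k + 1)) {T K : ℝ} (hT : 2 ≤ T) (hK0 : (m 0 : ℝ) ≤ K)
    (hK : ∀ k, (m (k + 1) : ℝ) ≤ T * m k + K) :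
    irrExp (lacunary m) ≤ ENNReal.ofReal T := by
  refine sSup_le ?_
  rintro _ ⟨t, rfl, hinf⟩
  by_contra! hlt
  have hTt : T < t := by
    by_contra! h
    exact hlt.not_ge (ENNReal.ofReal_le_ofReal h)
  obtain ⟨D, hD⟩ := exists_nat_ge (K / (t - T))
  refine hinf (((finite_setOf_natDegree_le D).prod (finite_setOf_natDegree_le D)).subset ?_)
  rintro ⟨g, h⟩ ⟨hh, hgh⟩
  dsimp only at hh hgh
  rw [absv_toL hh, ← Real.rpow_natCast, ← Real.rpow_mul (by norm_num)] at hgh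
  have hexp := (Real.rpow_lt_rpow_left_iff (by norm_num : (1 : ℝ) < 3)).mp
    ((le_absv_lacunary_sub hm hm2 hT hK0 hK g h hh).trans_lt hgh)
  have hhD : h.natDegree ≤ D := by
    have : (h.natDegree : ℝ) ≤ D := by
      refine le_trans ?_ hD
      rw [le_div_iff₀ (by linarith)]
      linarith
    exact_mod_cast this
  refine ⟨?_, hhD⟩
  by_cases hg : g = 0
  · simp [hg]
  have hone : absv (lacunary m - toL g / toL h) ≤ 1 := by
    refine hgh.le.trans (Real.rpow_le_one_of_one_le_of_nonpos (by norm_num) ?_)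
    have : (0 : ℝ) ≤ h.natDegree := by positivity
    nlinarith
  have hfrac : absv (toL g / toL h) ≤ 1 := by
    have h1 := absv_add_le (lacunary m) (-(lacunary m - toL g / toL h))
    rw [absv_neg, neg_sub, add_sub_cancel] at h1
    exact h1.trans (max_le (absv_le_one_of_mem_Cantor (lacunary_mem_Cantor hm h0)) hone)
  have hmul : absv (toL g) ≤ absv (toL h) := by
    have := absv_mul (toL g / toL h) (toL h)
    rw [div_mul_cancel₀ _ (toL_ne_zero hh)] at this
    rw [this]
    exact mul_le_of_le_one_left (absv_nonneg _) hfrac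
  rw [absv_toL hg, absv_toL hh, pow_le_pow_iff_right₀ (by norm_num)] at hmul
  exact hmul.trans hhD

/-- The sequence starting at `1` with `m (k + 1) = c k (m k)`, or one more when `ε k` holds. -/
def perturbedSeq (c : ℕ → ℕ → ℕ) (ε : ℕ → Bool) : ℕ → ℕ
  | 0 => 1
  | k + 1 => c k (perturbedSeq c ε k) + (ε k).toNat

theorem perturbedSeq_pos {c : ℕ → ℕ → ℕ} (hc : ∀ k n, 2 * n ≤ c k n) (ε : ℕ → Bool) (k : ℕ) :
    0 < perturbedSeq c ε k := by
  induction k with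
  | zero => exact one_pos
  | succ k ih =>
    have := hc k (perturbedSeq c ε k)
    rw [perturbedSeq]
    omega

theorem two_mul_perturbedSeq_le {c : ℕ → ℕ → ℕ} (hc : ∀ k n, 2 * n ≤ c k n) (ε : ℕ → Bool)
    (k : ℕ) : 2 * perturbedSeq c ε k ≤ perturbedSeq c ε (k + 1) :=
  (hc k _).trans (Nat.le_add_right _ _)

theorem perturbedSeq_strictMono {c : ℕ → ℕ → ℕ} (hc : ∀ k n, 2 * n ≤ c k n) (ε : ℕ → Bool) :
    StrictMono (perturbedSeq c ε) :=
  strictMono_nat_of_lt_succ fun k => by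
    have := two_mul_perturbedSeq_le hc ε k
    have := perturbedSeq_pos hc ε k
    omega

theorem perturbedSeq_injective (c : ℕ → ℕ → ℕ) : Function.Injective (perturbedSeq c) := by
  intro ε ε' h
  funext k
  have h1 := congrFun h (k + 1)
  rw [perturbedSeq, perturbedSeq, congrFun h k] at h1
  cases h2 : ε k <;> cases h3 : ε' k <;> simp_all

theorem not_countable_of_perturbedSeq {c : ℕ → ℕ → ℕ} (hc : ∀ k n, 2 * n ≤ c k n) {τ : ℝ≥0∞}
    (h : ∀ ε, irrExp (lacunary (perturbedSeq c ε)) = τ) :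
    ¬ {ξ ∈ Cantor | irrExp ξ = τ}.Countable := by
  intro hcount
  have hinj : Function.Injective fun ε => lacunary (perturbedSeq c ε) := fun ε ε' he =>
    perturbedSeq_injective c (lacunary_injOn (perturbedSeq_strictMono hc ε)
      (perturbedSeq_strictMono hc ε') he)
  have hmem : ∀ ε, lacunary (perturbedSeq c ε) ∈ {ξ ∈ Cantor | irrExp ξ = τ} := fun ε =>
    ⟨lacunary_mem_Cantor (perturbedSeq_strictMono hc ε) (perturbedSeq_pos hc ε 0), h ε⟩
  have huniv : (Set.univ : Set (ℕ → Bool)).Countable :=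
    (hcount.preimage_of_injOn hinj.injOn).mono fun ε _ => hmem ε
  have : Uncountable (ℕ → Bool) := by
    rw [← Cardinal.aleph0_lt_mk_iff]
    simpa using Cardinal.cantor Cardinal.aleph0
  exact not_countable (Set.countable_univ_iff.mp huniv)

/-- For any `τ ∈ [2, ∞]` there exist uncountably many elements of the
Cantor set `𝒞` with irrationality exponent `τ`. -/
theorem uncountably_many_with_irrExp (τ : ℝ≥0∞) (hτ : 2 ≤ τ) :
    ¬ {ξ ∈ Cantor | irrExp ξ = τ}.Countable := by
  rcases eq_or_ne τ ⊤ with rfl | htop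
  · have hc : ∀ k n : ℕ, 2 * n ≤ (k + 2) * n := fun k n => Nat.mul_le_mul_right n (by omega)
    refine not_countable_of_perturbedSeq hc fun ε => top_le_iff.mp ?_
    refine ENNReal.le_of_forall_nnreal_lt fun r _ => ?_
    obtain ⟨k₀, hk₀⟩ := exists_nat_ge (r : ℝ)
    rw [← ENNReal.ofReal_coe_nnreal]
    refine le_irrExp_lacunary (perturbedSeq_strictMono hc ε) (k₀ := k₀) fun k hk => ?_
    have hpos : (0 : ℝ) < perturbedSeq (fun k n => (k + 2) * n) ε k := by
      exact_mod_cast perturbedSeq_pos hc ε k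
    have hk' : (k₀ : ℝ) ≤ k := by exact_mod_cast hk
    rw [perturbedSeq]
    push_cast
    nlinarith [(ε k).toNat.cast_nonneg (α := ℝ)]
  · obtain ⟨T, hT0, rfl⟩ : ∃ T : ℝ, 0 ≤ T ∧ τ = ENNReal.ofReal T :=
      ⟨τ.toReal, ENNReal.toReal_nonneg, (ENNReal.ofReal_toReal htop).symm⟩
    have hT : 2 ≤ T := by
      rw [← ENNReal.ofReal_ofNat, ENNReal.ofReal_le_ofReal_iff hT0] at hτ
      exact hτ
    have hc : ∀ k n : ℕ, 2 * n ≤ (fun _ n : ℕ => ⌈T * n⌉₊) k n := fun _ n => by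
      have : ((2 * n : ℕ) : ℝ) ≤ ⌈T * n⌉₊ := by
        refine le_trans ?_ (Nat.le_ceil _)
        push_cast
        gcongr
      exact_mod_cast this
    refine not_countable_of_perturbedSeq hc fun ε => le_antisymm ?_ ?_
    · refine irrExp_lacunary_le (perturbedSeq_strictMono hc ε) (perturbedSeq_pos hc ε 0)
        (two_mul_perturbedSeq_le hc ε) (K := 2) hT (by simp [perturbedSeq]) fun k => ?_
      have h1 : ((ε k).toNat : ℝ) ≤ 1 := by exact_mod_cast Bool.toNat_le (ε k)
      have h2 := (Nat.ceil_lt_add_one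
        (by positivity : 0 ≤ T * perturbedSeq (fun _ n : ℕ => ⌈T * n⌉₊) ε k)).le
      rw [perturbedSeq]
      push_cast
      linarith
    · refine ENNReal.le_of_forall_nnreal_lt fun r hr => ?_
      rw [← ENNReal.ofReal_coe_nnreal] at hr ⊢
      have hrT := (ENNReal.ofReal_lt_ofReal_iff (by linarith)).mp hr
      refine le_irrExp_lacunary (perturbedSeq_strictMono hc ε) (k₀ := 0) fun k _ => ?_
      have hpos : (0 : ℝ) < perturbedSeq (fun _ n : ℕ => ⌈T * n⌉₊) ε k := by
        exact_mod_cast perturbedSeq_pos hc ε k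
      have h2 := Nat.le_ceil (T * perturbedSeq (fun _ n : ℕ => ⌈T * n⌉₊) ε k)
      rw [perturbedSeq]
      push_cast
      nlinarith [(ε k).toNat.cast_nonneg (α := ℝ)]
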